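/- Let k ≥ 2, let G be a simple graph on a finite vertex set, and let r be a P_k^{**}-role colouring of G. Suppose u_0, u_1, …, u_{2k} are pairwise distinct vertices of G such that u_{i−1} is adjacent to u_i for every 1 ≤ i ≤ 2k, and such that deg_G(u_i) = 2 for every 1 ≤ i ≤ 2k−1. Then r(u_0) = r(u_{2k}). -/

import Mathlib

/-- Adjacency relation of the role graph `P_k^{**}`: the path on `Fin k`
with loops at both ends. -/
def pathStarStarAdj (k : ℕ) (i j : Fin k) : Prop :=
  (i.val + 1 = j.val ∨ j.val + 1 = i.val) ∨ (i = j ∧ (i.val = 0 ∨ i.val = k - 1))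

/-- An `A`-role colouring of `G`: the image of every open neighbourhood
equals the `A`-neighbourhood of the vertex's colour. -/
def IsRoleColoring {V : Type*} {k : ℕ} (G : SimpleGraph V)
    (A : Fin k → Fin k → Prop) (r : V → Fin k) : Prop :=
  ∀ v : V, r '' (G.neighborSet v) = {j : Fin k | A (r v) j}

/-- The colour at position `m` of the closed walk of length `2 * k` that traverses
`P_k^{**}` forwards and then backwards, using each loop once per round. -/
def pathStarStarColor (k m : ℕ) : ℕ :=
  if m % (2 * k) < k then m % (2 * k) else 2 * k - 1 - m % (2 * k)

theorem succ_mod_eq_ite (n m : ℕ) (hn : 0 < n) :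
    (m + 1) % n = if m % n + 1 = n then 0 else m % n + 1 := by
  have hlt := Nat.mod_lt m hn
  rw [← Nat.mod_add_mod]
  split_ifs with h
  · rw [h, Nat.mod_self]
  · exact Nat.mod_eq_of_lt (by omega)

theorem pathStarStarColor_ne_add_two (k m : ℕ) (hk : 2 ≤ k) :
    pathStarStarColor k m ≠ pathStarStarColor k (m + 2) := by
  have hlt := Nat.mod_lt m (show 0 < 2 * k by omega)
  have h1 := succ_mod_eq_ite (2 * k) m (by omega)
  have h2 := succ_mod_eq_ite (2 * k) (m + 1) (by omega)
  unfold pathStarStarColor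
  rw [show m + 2 = m + 1 + 1 from rfl, h2, h1]
  generalize m % (2 * k) = a at *
  split_ifs <;> omega

theorem pathStarStarAdj_of_color {k : ℕ} (hk : 2 ≤ k) {m : ℕ} {x y : Fin k}
    (hx : x.val = pathStarStarColor k m) (hy : y.val = pathStarStarColor k (m + 1)) :
    pathStarStarAdj k x y := by
  have hlt := Nat.mod_lt m (show 0 < 2 * k by omega)
  have h1 := succ_mod_eq_ite (2 * k) m (by omega)
  unfold pathStarStarColor at hx hy
  rw [h1] at hy
  unfold pathStarStarAdj
  rw [Fin.ext_iff]
  generalize m % (2 * k) = a at *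
  split_ifs at hx hy <;> omega

theorem pathStarStarColor_lt {k : ℕ} (hk : 2 ≤ k) (m : ℕ) : pathStarStarColor k m < k := by
  unfold pathStarStarColor
  split_ifs <;> omega

theorem pathStarStarColor_add_period (k m : ℕ) :
    pathStarStarColor k (m + 2 * k) = pathStarStarColor k m := by
  simp [pathStarStarColor]

/-- Every arc of `P_k^{**}` is traversed by the closed walk `pathStarStarColor k`. -/
theorem exists_pathStarStarColor_of_adj {k : ℕ} (hk : 2 ≤ k) {x y : Fin k}
    (h : pathStarStarAdj k x y) :
    ∃ p, x.val = pathStarStarColor k p ∧ y.val = pathStarStarColor k (p + 1) := by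
  have hx := x.isLt
  have hy := y.isLt
  have key : ∀ p < 2 * k, x.val = (if p < k then p else 2 * k - 1 - p) →
      y.val = (if p + 1 = 2 * k then 0 else if p + 1 < k then p + 1 else 2 * k - 1 - (p + 1)) →
      ∃ p, x.val = pathStarStarColor k p ∧ y.val = pathStarStarColor k (p + 1) := by
    intro p hp h1 h2
    refine ⟨p, ?_, ?_⟩
    · rw [pathStarStarColor, Nat.mod_eq_of_lt hp, h1]
    · rw [pathStarStarColor, succ_mod_eq_ite _ _ (by omega), Nat.mod_eq_of_lt hp, h2]
      split_ifs <;> omega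
  unfold pathStarStarAdj at h
  rw [Fin.ext_iff] at h
  rcases h with (h | h) | ⟨h, h0 | h0⟩
  · exact key x (by omega) (by split_ifs <;> omega) (by split_ifs <;> omega)
  · exact key (2 * k - 1 - x) (by omega) (by split_ifs <;> omega) (by split_ifs <;> omega)
  · exact key (2 * k - 1) (by omega) (by split_ifs <;> omega) (by split_ifs <;> omega)
  · exact key (k - 1) (by omega) (by split_ifs <;> omega) (by split_ifs <;> omega)

theorem IsRoleColoring.adj {V : Type*} {k : ℕ} {G : SimpleGraph V}
    {A : Fin k → Fin k → Prop} {r : V → Fin k} (hr : IsRoleColoring G A r) {v w : V}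
    (h : G.Adj v w) : A (r v) (r w) := by
  have hmem : r w ∈ r '' G.neighborSet v := ⟨w, h, rfl⟩
  rwa [hr v] at hmem

/-- At a vertex of degree two, every role adjacent to its role is the role of one of its
two neighbours. -/
theorem IsRoleColoring.eq_or_eq_of_degree_eq_two {V : Type*} [Fintype V] {k : ℕ}
    {G : SimpleGraph V} [DecidableRel G.Adj] {A : Fin k → Fin k → Prop} {r : V → Fin k}
    (hr : IsRoleColoring G A r) {v a b : V} (hdeg : G.degree v = 2) (ha : G.Adj v a)
    (hb : G.Adj v b) (hab : a ≠ b) {j : Fin k} (hj : A (r v) j) : j = r a ∨ j = r b := by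
  classical
  have hmem : j ∈ r '' G.neighborSet v := by rw [hr v]; exact hj
  obtain ⟨w, hw, rfl⟩ := hmem
  have hN : ({a, b} : Finset V) = G.neighborFinset v := by
    apply Finset.eq_of_subset_of_card_le
    · intro z hz
      rw [Finset.mem_insert, Finset.mem_singleton] at hz
      rcases hz with rfl | rfl <;> simpa
    · rw [Finset.card_pair hab, G.card_neighborFinset_eq_degree, hdeg]
  have hwN : w ∈ G.neighborFinset v := by simpa using hw
  rw [← hN, Finset.mem_insert, Finset.mem_singleton] at hwN
  exact hwN.imp (congrArg r) (congrArg r)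

theorem pathStarStar_role_coloring_period {V : Type*} [Fintype V]
    (G : SimpleGraph V) [DecidableRel G.Adj]
    (k : ℕ) (hk : 2 ≤ k) (r : V → Fin k)
    (hr : IsRoleColoring G (pathStarStarAdj k) r)
    (u : ℕ → V)
    (hinj : ∀ i j : ℕ, i ≤ 2 * k → j ≤ 2 * k → u i = u j → i = j)
    (hadj : ∀ i : ℕ, 1 ≤ i → i ≤ 2 * k → G.Adj (u (i - 1)) (u i))
    (hdeg : ∀ i : ℕ, 1 ≤ i → i ≤ 2 * k - 1 → G.degree (u i) = 2) :
    r (u 0) = r (u (2 * k)) := by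
  obtain ⟨p, hp0, hp1⟩ := exists_pathStarStarColor_of_adj hk
    (hr.adj (hadj 1 le_rfl (by omega)))
  have walk : ∀ i, i + 1 ≤ 2 * k → (r (u i)).val = pathStarStarColor k (p + i) ∧
      (r (u (i + 1))).val = pathStarStarColor k (p + i + 1) := by
    intro i
    induction i with
    | zero => exact fun _ => ⟨hp0, hp1⟩
    | succ i ih =>
      intro hi
      obtain ⟨h0, h1⟩ := ih (by omega)
      refine ⟨h1, ?_⟩
      have hne : u i ≠ u (i + 2) := fun h => by
        have := hinj i (i + 2) (by omega) (by omega) h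
        omega
      let c : Fin k := ⟨pathStarStarColor k (p + i + 2), pathStarStarColor_lt hk _⟩
      have hc : pathStarStarAdj k (r (u (i + 1))) c := pathStarStarAdj_of_color hk h1 rfl
      rcases hr.eq_or_eq_of_degree_eq_two (hdeg (i + 1) (by omega) (by omega))
        (hadj (i + 1) (by omega) (by omega)).symm (hadj (i + 2) (by omega) (by omega))
        hne hc with h | h
      · exact absurd (h0.symm.trans (congrArg Fin.val h).symm)
          (pathStarStarColor_ne_add_two k (p + i) hk)
      · exact (congrArg Fin.val h).symm
  have hlast := (walk (2 * k - 1) (by omega)).2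
  rw [add_assoc, Nat.sub_add_cancel (by omega), pathStarStarColor_add_period] at hlast
  exact Fin.ext (hp0.trans hlast.symm)
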